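/- Let α > 0 and ξ > 4 be real numbers. There exists N₀ = N₀(α, ξ) such that for all n ≥ N₀ the following holds: if G is a finite simple graph on n vertices with minimum degree δ(G) ≥ (1+α)·log₂ n and Cheeger constant Φ(G) > ξ·(log₂ log₂ n)/(log₂ n), then for every integer k with (α/2)·log₂ n ≤ k ≤ n, the probability (over a uniformly random orientation of G) that some set X of exactly k vertices induces a connected subgraph of G, satisfies vol(X) ≤ vol(G)/2, and has either no edge directed into X or no edge directed out of X, is at most 2^{−(log₂ k + 2k + 2)}. -/

import Mathlib

open Finset

variable {n : ℕ}

/-- `f e = true` means the edge `e` is directed from its smaller endpoint to its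
larger endpoint. `dirAdj G f u v` says the orientation `f` directs an edge from `u` to `v`. -/
def dirAdj (G : SimpleGraph (Fin n)) (f : G.edgeSet → Bool) (u v : Fin n) : Prop :=
  ∃ h : G.Adj u v, f ⟨s(u, v), (SimpleGraph.mem_edgeSet G).mpr h⟩ = decide (u < v)

/-- Probability of an event under a uniformly random orientation of `G`. -/
noncomputable def orientProb (G : SimpleGraph (Fin n)) [DecidableRel G.Adj]
    (P : (G.edgeSet → Bool) → Prop) : ℝ :=
  ((@Finset.filter _ P (Classical.decPred _) Finset.univ).card : ℝ) /
    (Fintype.card (G.edgeSet → Bool) : ℝ)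

/-- The volume of a vertex subset: the sum of the degrees of its vertices. -/
def vol (G : SimpleGraph (Fin n)) [DecidableRel G.Adj] (X : Finset (Fin n)) : ℕ :=
  ∑ v ∈ X, G.degree v

/-- `e(X, X̄)`: the number of edges of `G` with exactly one endpoint in `X`. -/
def crossCount (G : SimpleGraph (Fin n)) [DecidableRel G.Adj] (X : Finset (Fin n)) : ℕ :=
  ((X ×ˢ Xᶜ).filter fun p => G.Adj p.1 p.2).card

/-- No edge of the orientation is directed from the complement of `X` into `X`. -/
def NoEdgeIn (G : SimpleGraph (Fin n)) (f : G.edgeSet → Bool) (X : Finset (Fin n)) : Prop :=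
  ∀ u v : Fin n, u ∉ X → v ∈ X → ¬ dirAdj G f u v

/-- No edge of the orientation is directed from `X` into its complement. -/
def NoEdgeOut (G : SimpleGraph (Fin n)) (f : G.edgeSet → Bool) (X : Finset (Fin n)) : Prop :=
  ∀ u v : Fin n, u ∈ X → v ∉ X → ¬ dirAdj G f u v

/-- `X` induces a connected subgraph of `G`, has volume at most half of the total,
and (in the orientation `f`) has either no edge entering it or no edge leaving it. -/
def BadSet (G : SimpleGraph (Fin n)) [DecidableRel G.Adj]
    (f : G.edgeSet → Bool) (X : Finset (Fin n)) : Prop :=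
  (G.induce (X : Set (Fin n))).Connected ∧ 2 * vol G X ≤ vol G Finset.univ ∧
    (NoEdgeIn G f X ∨ NoEdgeOut G f X)

section Percolation

variable {V : Type*} [Fintype V] [DecidableEq V]

theorem sum_superset_disjoint_weight (p : ℝ) {X B : Finset V} (h : Disjoint X B) :
    ∑ S : Finset V with X ⊆ S ∧ Disjoint S B, p ^ #S * (1 - p) ^ #Sᶜ =
      p ^ #X * (1 - p) ^ #B := by
  have key := Finset.prod_add (fun i => if i ∈ B then 0 else p)
    (fun i => if i ∈ X then 0 else 1 - p) (univ : Finset V)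
  have hl : ∏ i : V, ((if i ∈ B then 0 else p) + (if i ∈ X then 0 else 1 - p)) =
      p ^ #X * (1 - p) ^ #B := by
    have : ∀ i : V, ((if i ∈ B then 0 else p) + (if i ∈ X then 0 else 1 - p)) =
        (if i ∈ X then p else 1) * (if i ∈ B then 1 - p else 1) := by
      intro i
      by_cases hB : i ∈ B
      · simp [hB, Finset.disjoint_right.1 h hB]
      · by_cases hX : i ∈ X <;> simp [hB, hX]
    simp_rw [this, Finset.prod_mul_distrib, Finset.prod_ite_mem, Finset.univ_inter,
      Finset.prod_const]
  rw [hl] at key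
  rw [key, Finset.powerset_univ, Finset.sum_filter]
  refine Finset.sum_congr rfl fun S _ => ?_
  rw [← Finset.compl_eq_univ_sdiff]
  split_ifs with hS
  · rw [Finset.prod_congr rfl (g := fun _ => p), Finset.prod_congr (s₁ := Sᶜ) rfl
      (g := fun _ => 1 - p), Finset.prod_const, Finset.prod_const]
    · intro i hi
      rw [if_neg fun hX => (Finset.mem_compl.1 hi) (hS.1 hX)]
    · intro i hi
      rw [if_neg (Finset.disjoint_left.1 hS.2 hi)]
  · rw [not_and_or] at hS
    symm
    rcases hS with hS | hS
    · obtain ⟨i, hiX, hiS⟩ := Finset.not_subset.1 hS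
      exact mul_eq_zero_of_right _ (Finset.prod_eq_zero (Finset.mem_compl.2 hiS) (by simp [hiX]))
    · obtain ⟨i, hiS, hiB⟩ := Finset.not_disjoint_iff.1 hS
      exact mul_eq_zero_of_left (Finset.prod_eq_zero hiS (by simp [hiB])) _

/-- The vertices outside `X` with a neighbour in `X`. -/
def SimpleGraph.outerBoundary (G : SimpleGraph V) [DecidableRel G.Adj] (X : Finset V) :
    Finset V :=
  X.biUnion (fun v => G.neighborFinset v) \ X

variable (G : SimpleGraph V) [DecidableRel G.Adj]

theorem SimpleGraph.card_outerBoundary_le (X : Finset V) :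
    #(G.outerBoundary X) ≤ ∑ v ∈ X, G.degree v :=
  (Finset.card_le_card Finset.sdiff_subset).trans Finset.card_biUnion_le

variable {G}

theorem SimpleGraph.subset_of_induce_connected {X Y S : Finset V} {v : V}
    (hY : (G.induce (Y : Set V)).Connected) (hvX : v ∈ X) (hvY : v ∈ Y) (hYS : Y ⊆ S)
    (hS : Disjoint S (G.outerBoundary X)) : Y ⊆ X := by
  have hstep : ∀ a b : (Y : Set V), (G.induce (Y : Set V)).Walk a b → a.1 ∈ X → b.1 ∈ X := by
    intro a b w
    induction w with
    | nil => exact id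
    | @cons a c b hadj _ ih =>
      refine fun ha => ih ?_
      by_contra hc
      refine Finset.disjoint_left.1 hS (hYS c.2) ?_
      simp only [SimpleGraph.outerBoundary, Finset.mem_sdiff, Finset.mem_biUnion,
        SimpleGraph.mem_neighborFinset]
      exact ⟨⟨a, ha, hadj⟩, hc⟩
  intro y hy
  obtain ⟨w⟩ := hY.preconnected ⟨v, hvY⟩ ⟨y, hy⟩
  exact hstep _ _ w hvX

theorem SimpleGraph.sum_connected_weight_le_one {p : ℝ} (hp₀ : 0 ≤ p) (hp₁ : p ≤ 1) (v : V)
    (K : Finset (Finset V))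
    (hK : ∀ X ∈ K, v ∈ X ∧ (G.induce (X : Set V)).Connected) :
    ∑ X ∈ K, p ^ #X * (1 - p) ^ (∑ u ∈ X, G.degree u) ≤ 1 := by
  have hq : 0 ≤ 1 - p := by linarith
  calc ∑ X ∈ K, p ^ #X * (1 - p) ^ (∑ u ∈ X, G.degree u)
      ≤ ∑ X ∈ K, ∑ S : Finset V with X ⊆ S ∧ Disjoint S (G.outerBoundary X),
          p ^ #S * (1 - p) ^ #Sᶜ := by
        refine Finset.sum_le_sum fun X _ => ?_
        rw [sum_superset_disjoint_weight p (B := G.outerBoundary X) Finset.disjoint_sdiff]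
        exact mul_le_mul_of_nonneg_left
          (pow_le_pow_of_le_one hq (by linarith) (G.card_outerBoundary_le X)) (by positivity)
    _ = ∑ S ∈ K.biUnion fun X =>
          ({S | X ⊆ S ∧ Disjoint S (G.outerBoundary X)} : Finset (Finset V)),
          p ^ #S * (1 - p) ^ #Sᶜ := by
        refine (Finset.sum_biUnion fun X hX Y hY hne => Finset.disjoint_left.2 ?_).symm
        intro S hSX hSY
        simp only [Finset.mem_filter, Finset.mem_univ, true_and] at hSX hSY
        obtain ⟨hvX, hcX⟩ := hK X hX
        obtain ⟨hvY, hcY⟩ := hK Y hY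
        exact hne ((SimpleGraph.subset_of_induce_connected hcX hvY hvX hSX.1 hSY.2).antisymm
          (SimpleGraph.subset_of_induce_connected hcY hvX hvY hSY.1 hSX.2))
    _ ≤ ∑ S : Finset V, p ^ #S * (1 - p) ^ #Sᶜ :=
        Finset.sum_le_sum_of_subset_of_nonneg (Finset.subset_univ _)
          fun S _ _ => by positivity
    _ = 1 := by
        simpa using sum_superset_disjoint_weight p (Finset.disjoint_empty_left (∅ : Finset V))

end Percolation

theorem orientProb_le_sum {ι : Type*} (G : SimpleGraph (Fin n)) [DecidableRel G.Adj]
    (K : Finset ι) (P : (G.edgeSet → Bool) → Prop) (Q : ι → (G.edgeSet → Bool) → Prop)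
    (h : ∀ f, P f → ∃ i ∈ K, Q i f) :
    orientProb G P ≤ ∑ i ∈ K, orientProb G (Q i) := by
  classical
  unfold orientProb
  rw [← Finset.sum_div]
  refine div_le_div_of_nonneg_right ?_ (by positivity)
  rw [← Nat.cast_sum, Nat.cast_le]
  refine le_trans (Finset.card_le_card fun f hf => ?_) Finset.card_biUnion_le
  obtain ⟨i, hi, hQ⟩ := h f (Finset.mem_filter.1 hf).2
  exact Finset.mem_biUnion.2 ⟨i, hi, Finset.mem_filter.2 ⟨Finset.mem_univ _, hQ⟩⟩

theorem crossCount_compl (G : SimpleGraph (Fin n)) [DecidableRel G.Adj] (X : Finset (Fin n)) :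
    crossCount G Xᶜ = crossCount G X := by
  refine Finset.card_equiv (Equiv.prodComm _ _) fun p => ?_
  simp [G.adj_comm, and_comm]

theorem orientProb_noEdgeOut_le (G : SimpleGraph (Fin n)) [DecidableRel G.Adj]
    (X : Finset (Fin n)) :
    orientProb G (fun f => NoEdgeOut G f X) ≤ (1 / 2 : ℝ) ^ crossCount G X := by
  classical
  set C : Finset G.edgeSet := {e | ∃ u ∈ X, ∃ v ∉ X, s(u, v) = e.1}
  set t : G.edgeSet → Finset Bool := fun e =>
    {b | ∀ u ∈ X, ∀ v ∉ X, s(u, v) = e.1 → b ≠ decide (u < v)}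
  have hcard : crossCount G X ≤ #C := by
    refine le_trans ?_ (Finset.card_image_le (f := Subtype.val))
    refine Finset.card_le_card_of_injOn (fun p => s(p.1, p.2)) ?_ ?_
    · intro p hp
      simp only [Finset.coe_filter, Finset.mem_product, Finset.mem_compl, Set.mem_ofPred_eq] at hp
      exact Finset.mem_coe.2 (Finset.mem_image.2 ⟨⟨s(p.1, p.2), hp.2⟩, Finset.mem_filter.2
        ⟨Finset.mem_univ _, p.1, hp.1.1, p.2, hp.1.2, rfl⟩, rfl⟩)
    · rintro ⟨a, b⟩ hp ⟨c, d⟩ hq h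
      simp only [Finset.coe_filter, Finset.mem_product, Finset.mem_compl, Set.mem_ofPred_eq]
        at hp hq
      rcases Sym2.eq_iff.1 h with ⟨rfl, rfl⟩ | ⟨rfl, rfl⟩
      · rfl
      · exact absurd hp.1.1 hq.1.2
  have htC : ∀ e, #(t e) ≤ if e ∈ C then 1 else 2 := by
    intro e
    split_ifs with he
    · obtain ⟨u, hu, v, hv, huv⟩ := (Finset.mem_filter.1 he).2
      refine Finset.card_le_one.2 fun a ha b hb => ?_
      have h₁ := (Finset.mem_filter.1 ha).2 u hu v hv huv
      have h₂ := (Finset.mem_filter.1 hb).2 u hu v hv huv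
      exact (Bool.eq_not.2 h₁).trans (Bool.eq_not.2 h₂).symm
    · exact Finset.card_le_univ _
  have hle : #{f : G.edgeSet → Bool | NoEdgeOut G f X} ≤ 2 ^ #Cᶜ := by
    calc #{f : G.edgeSet → Bool | NoEdgeOut G f X} ≤ #(Fintype.piFinset t) := by
          refine Finset.card_le_card fun f hf => Fintype.mem_piFinset.2 fun e => ?_
          refine Finset.mem_filter.2 ⟨Finset.mem_univ _, fun u hu v hv huv hfe => ?_⟩
          obtain ⟨e, he⟩ := e
          subst huv
          exact (Finset.mem_filter.1 hf).2 u v hu hv ⟨he, hfe⟩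
      _ ≤ ∏ e : G.edgeSet, if e ∈ C then 1 else 2 := by
          rw [Fintype.card_piFinset]
          exact Finset.prod_le_prod' fun e _ => htC e
      _ = 2 ^ #Cᶜ := by
          rw [Finset.prod_ite, Finset.prod_const_one, one_mul, Finset.prod_const]
          congr 2
          ext; simp
  unfold orientProb
  rw [div_le_iff₀ (by positivity)]
  have hE : (Fintype.card (G.edgeSet → Bool) : ℝ) = 2 ^ #C * 2 ^ #Cᶜ := by
    rw [← pow_add, Finset.card_add_card_compl]
    simp
  calc _ ≤ ((2 ^ #Cᶜ : ℕ) : ℝ) := by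
        rw [Nat.cast_le]
        convert hle
    _ = (1 / 2 : ℝ) ^ #C * (2 ^ #C * 2 ^ #Cᶜ) := by
        rw [← mul_assoc, ← mul_pow]; norm_num
    _ ≤ _ := by
        rw [hE]
        exact mul_le_mul_of_nonneg_right
          (pow_le_pow_of_le_one (by norm_num) (by norm_num) hcard) (by positivity)

theorem orientProb_noEdge_le (G : SimpleGraph (Fin n)) [DecidableRel G.Adj]
    (X : Finset (Fin n)) :
    orientProb G (fun f => NoEdgeIn G f X ∨ NoEdgeOut G f X) ≤
      2 * (1 / 2 : ℝ) ^ crossCount G X := by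
  have h := orientProb_le_sum G ({X, Xᶜ} : Finset (Finset (Fin n)))
    (fun f => NoEdgeIn G f X ∨ NoEdgeOut G f X) (fun Y f => NoEdgeOut G f Y) ?_
  · refine h.trans ((Finset.sum_le_card_nsmul _ _ ((1 / 2 : ℝ) ^ crossCount G X) ?_).trans ?_)
    · intro Y hY
      rcases Finset.mem_insert.1 hY with rfl | hY
      · exact orientProb_noEdgeOut_le G _
      · rw [Finset.mem_singleton.1 hY, ← crossCount_compl G X]
        exact orientProb_noEdgeOut_le G _
    · rw [nsmul_eq_mul]
      exact mul_le_mul_of_nonneg_right (by exact_mod_cast Finset.card_le_two) (by positivity)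
  · rintro f (hf | hf)
    · exact ⟨Xᶜ, by simp, fun u v hu hv =>
        hf u v (Finset.mem_compl.1 hu) (by simpa using hv)⟩
    · exact ⟨X, by simp, hf⟩

theorem vol_add_vol_compl (G : SimpleGraph (Fin n)) [DecidableRel G.Adj] (X : Finset (Fin n)) :
    vol G X + vol G Xᶜ = vol G univ :=
  Finset.sum_add_sum_compl _ _

/-- The weight `2 ^ (-c)` of a cut of size `c > ξ (log₂ L / L) D` is dominated by the
percolation weight `(1 - 1 / L) ^ D`, with a gain that is exponential in `k ≤ D / L`. -/
theorem half_pow_le_of_cheeger {L ξ : ℝ} {c D k : ℕ} (hξ : 4 < ξ) (hL : 576 ≤ L)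
    (hD : L * k ≤ D) (hc : ξ * (Real.logb 2 L / L) * D ≤ c) :
    (1 / 2 : ℝ) ^ c ≤ (1 - 1 / L) ^ D * (9 / L ^ 4) ^ k := by
  have hL0 : 0 < L := by linarith
  have hln2 : 0 < Real.log 2 := Real.log_pos (by norm_num)
  have hlnL : 1 ≤ Real.log L := by
    rw [Real.le_log_iff_exp_le hL0]
    linarith [Real.exp_one_lt_d9]
  have hDL : (k : ℝ) ≤ D / L := by
    rw [le_div_iff₀ hL0]; linarith
  have hq : Real.exp (-(2 / L)) ≤ 1 - 1 / L := by
    have hpL : 1 / L ≤ 1 / 2 := one_div_le_one_div_of_le (by norm_num) (by linarith)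
    rw [← Real.le_log_iff_exp_le (by linarith)]
    refine le_trans ?_ (Real.one_sub_inv_le_log_of_pos (by linarith))
    have : (1 - 1 / L)⁻¹ ≤ 1 + 2 / L := by
      rw [inv_le_iff_one_le_mul₀ (by linarith)]
      have h0 : 0 ≤ 1 / L := by positivity
      have : 2 / L = 2 * (1 / L) := by ring
      rw [this]
      nlinarith
    linarith
  have hnine : Real.exp 2 ≤ 9 := by
    have : Real.exp 2 = Real.exp 1 * Real.exp 1 := by rw [← Real.exp_add]; norm_num
    rw [this]
    nlinarith [Real.exp_one_lt_d9, Real.exp_pos 1]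
  have hc' : ξ * Real.log L * (D / L) ≤ c * Real.log 2 := by
    have := mul_le_mul_of_nonneg_right hc hln2.le
    refine le_trans (le_of_eq ?_) this
    unfold Real.logb
    field_simp
  calc (1 / 2 : ℝ) ^ c = Real.exp (-(c * Real.log 2)) := by
        rw [Real.exp_neg, Real.exp_nat_mul, Real.exp_log (by norm_num)]
        simp
    _ ≤ Real.exp (D * (-(2 / L)) + k * (2 - 4 * Real.log L)) := by
        rw [Real.exp_le_exp]
        have h₁ : (4 * Real.log L - 2) * k ≤ (4 * Real.log L - 2) * (D / L) :=
          mul_le_mul_of_nonneg_left hDL (by linarith)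
        have h₂ : 4 * Real.log L * (D / L) ≤ ξ * Real.log L * (D / L) := by gcongr
        have h₃ : D * (-(2 / L)) = -2 * (D / L) := by ring
        rw [h₃]
        linarith
    _ = Real.exp (-(2 / L)) ^ D * (Real.exp 2 / L ^ 4) ^ k := by
        rw [Real.exp_add, Real.exp_nat_mul, Real.exp_nat_mul, Real.exp_sub]
        congr 3
        rw [show (4 : ℝ) * Real.log L = (4 : ℕ) * Real.log L by norm_num, Real.exp_nat_mul,
          Real.exp_log hL0]
    _ ≤ _ := by
        have := (Real.exp_pos _).le.trans hq
        gcongr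

theorem card_mul_weight_le {α L : ℝ} {n k : ℕ} (hα : 0 < α) (hn : (n : ℝ) = 2 ^ L) (hk : 1 ≤ k)
    (hkL : α / 2 * L ≤ k) (hL : 576 * (2 : ℝ) ^ (2 / α) ≤ L) :
    n * (2 * (L * (9 / L ^ 4)) ^ k) ≤ (2 : ℝ) ^ (-(Real.logb 2 k + 2 * k + 2)) := by
  have hA : (1 : ℝ) ≤ 2 ^ (2 / α) := Real.one_le_rpow (by norm_num) (by positivity)
  have hL0 : 0 < L := by linarith
  have hL1 : 1 ≤ L := by linarith
  have hk0 : (0 : ℝ) < k := by exact_mod_cast hk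
  have hn' : (n : ℝ) ≤ ((2 : ℝ) ^ (2 / α)) ^ k := by
    rw [hn, ← Real.rpow_natCast, ← Real.rpow_mul (by norm_num)]
    refine Real.rpow_le_rpow_of_exponent_le (by norm_num) ?_
    rw [div_mul_eq_mul_div, le_div_iff₀ hα]
    linarith
  have hrhs : (2 : ℝ) ^ (-(Real.logb 2 k + 2 * k + 2)) = ((k : ℝ) * 4 ^ k * 4)⁻¹ := by
    rw [Real.rpow_neg (by norm_num), Real.rpow_add (by norm_num), Real.rpow_add (by norm_num),
      Real.rpow_logb (by norm_num) (by norm_num) hk0, Real.rpow_mul (by norm_num),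
      Real.rpow_natCast]
    norm_num
  rw [hrhs, ← one_div, le_div_iff₀ (by positivity)]
  have hk2 : (k : ℝ) ≤ 2 ^ k := by exact_mod_cast Nat.lt_two_pow_self.le
  have h8 : (8 : ℝ) ≤ 8 ^ k := le_self_pow₀ (by norm_num) (by omega)
  have hbase : (2 : ℝ) ^ (2 / α) * (L * (9 / L ^ 4)) * 2 * 4 * 8 ≤ 1 := by
    have : (2 : ℝ) ^ (2 / α) * (L * (9 / L ^ 4)) * 2 * 4 * 8 =
        576 * (2 : ℝ) ^ (2 / α) / L ^ 3 := by
      field_simp; norm_num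
    rw [this, div_le_one (by positivity)]
    exact hL.trans (le_self_pow₀ hL1 (by norm_num))
  calc n * (2 * (L * (9 / L ^ 4)) ^ k) * (k * 4 ^ k * 4)
      = n * (L * (9 / L ^ 4)) ^ k * k * 4 ^ k * 8 := by ring
    _ ≤ ((2 : ℝ) ^ (2 / α)) ^ k * (L * (9 / L ^ 4)) ^ k * 2 ^ k * 4 ^ k * 8 ^ k := by gcongr
    _ = ((2 : ℝ) ^ (2 / α) * (L * (9 / L ^ 4)) * 2 * 4 * 8) ^ k := by
        simp only [mul_pow]
    _ ≤ 1 := pow_le_one₀ (by positivity) hbase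

/-- Under the hypotheses of Theorem 1.1, for every `k` with `(α/2)·log₂ n ≤ k ≤ n`,
the probability `P(B_k)` that some `k`-vertex connected set of at most half the total
volume has no edge in or no edge out is at most `2^{−(log₂ k + 2k + 2)}`. -/
theorem bad_k_set_probability_bound (α ξ : ℝ) (hα : 0 < α) (hξ : 4 < ξ) :
    ∃ N₀ : ℕ, ∀ n : ℕ, N₀ ≤ n → ∀ (G : SimpleGraph (Fin n)) [DecidableRel G.Adj],
      (∀ v : Fin n, (1 + α) * Real.logb 2 n ≤ (G.degree v : ℝ)) →
      (∀ X : Finset (Fin n), X.Nonempty → X ≠ Finset.univ →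
        ξ * (Real.logb 2 (Real.logb 2 n) / Real.logb 2 n) <
          (crossCount G X : ℝ) / min ((vol G X : ℝ)) ((vol G Xᶜ : ℝ))) →
      ∀ k : ℕ, α / 2 * Real.logb 2 n ≤ (k : ℝ) → k ≤ n →
        orientProb G (fun f => ∃ X : Finset (Fin n), X.card = k ∧ BadSet G f X) ≤
          (2 : ℝ) ^ (-(Real.logb 2 k + 2 * k + 2)) := by
  refine ⟨⌈(2 : ℝ) ^ (576 * (2 : ℝ) ^ (2 / α))⌉₊, ?_⟩
  intro n hn G _ hdeg hcheeger k hk hkn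
  classical
  set L := Real.logb 2 n
  have hA : (1 : ℝ) ≤ 2 ^ (2 / α) := Real.one_le_rpow (by norm_num) (by positivity)
  have hn₁ : (2 : ℝ) ^ (576 * (2 : ℝ) ^ (2 / α)) ≤ n := Nat.ceil_le.1 hn
  have hn₀ : (0 : ℝ) < n := lt_of_lt_of_le (by positivity) hn₁
  have hL : 576 * (2 : ℝ) ^ (2 / α) ≤ L := (Real.le_logb_iff_rpow_le (by norm_num) hn₀).2 hn₁
  have hL' : 576 ≤ L := by linarith
  have hnL : (n : ℝ) = 2 ^ L := (Real.rpow_logb (by norm_num) (by norm_num) hn₀).symm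
  have hk1 : 1 ≤ k := by
    have : (0 : ℝ) < k := lt_of_lt_of_le (by positivity) hk
    exact_mod_cast this
  have hdegL : ∀ v, L ≤ G.degree v := fun v => by nlinarith [hdeg v]
  have hp₁ : 1 / L ≤ 1 := by rw [div_le_one] <;> linarith
  have hp₀ : 0 ≤ 1 / L := by positivity
  set K : Finset (Finset (Fin n)) :=
    {X | #X = k ∧ (G.induce (X : Set (Fin n))).Connected ∧ 2 * vol G X ≤ vol G univ}
  have hvol : ∀ X ∈ K, L * k ≤ vol G X := by
    intro X hX
    rw [← (Finset.mem_filter.1 hX).2.1, vol, Nat.cast_sum, mul_comm, ← nsmul_eq_mul]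
    exact Finset.card_nsmul_le_sum _ _ _ fun v _ => hdegL v
  have hcut : ∀ X ∈ K, ξ * (Real.logb 2 L / L) * vol G X ≤ crossCount G X := by
    intro X hX
    have hpos : (0 : ℝ) < vol G X :=
      lt_of_lt_of_le (by have : (0 : ℝ) < k := by exact_mod_cast hk1
                         positivity) (hvol X hX)
    obtain ⟨hcard, -, h2⟩ := (Finset.mem_filter.1 hX).2
    have hsum := vol_add_vol_compl G X
    have hne : X ≠ univ := by
      rintro rfl
      have : 0 < vol G (univ : Finset (Fin n)) := by exact_mod_cast hpos
      omega
    have h := hcheeger X (Finset.card_pos.1 (by omega)) hne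
    rw [min_eq_left (by exact_mod_cast (by omega : vol G X ≤ vol G Xᶜ)),
      lt_div_iff₀ hpos] at h
    exact h.le
  have hprob : orientProb G (fun f => ∃ X : Finset (Fin n), X.card = k ∧ BadSet G f X) ≤
      ∑ X ∈ K, orientProb G (fun f => NoEdgeIn G f X ∨ NoEdgeOut G f X) := by
    refine orientProb_le_sum G K _ _ ?_
    rintro f ⟨X, hXk, hconn, h2, hf⟩
    exact ⟨X, Finset.mem_filter.2 ⟨Finset.mem_univ _, hXk, hconn, h2⟩, hf⟩
  have hterm : ∀ X ∈ K, orientProb G (fun f => NoEdgeIn G f X ∨ NoEdgeOut G f X) ≤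
      2 * (L * (9 / L ^ 4)) ^ k * ((1 / L) ^ #X * (1 - 1 / L) ^ vol G X) := by
    intro X hX
    refine (orientProb_noEdge_le G X).trans ?_
    have h := half_pow_le_of_cheeger hξ hL' (hvol X hX) (hcut X hX)
    have hpow : L ^ k * (1 / L) ^ k = 1 := by
      rw [← mul_pow, mul_one_div_cancel (by linarith), one_pow]
    rw [(Finset.mem_filter.1 hX).2.1, mul_pow]
    calc 2 * (1 / 2 : ℝ) ^ crossCount G X
        ≤ 2 * ((1 - 1 / L) ^ vol G X * (9 / L ^ 4) ^ k) := by gcongr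
      _ = 2 * ((1 - 1 / L) ^ vol G X * (9 / L ^ 4) ^ k) * (L ^ k * (1 / L) ^ k) := by
          rw [hpow, mul_one]
      _ = _ := by ring
  have hq : 0 ≤ 1 - 1 / L := by linarith
  have hcover : ∑ X ∈ K, (1 / L) ^ #X * (1 - 1 / L) ^ vol G X ≤ n := by
    calc ∑ X ∈ K, (1 / L) ^ #X * (1 - 1 / L) ^ vol G X
        ≤ ∑ X ∈ K, ∑ _v ∈ X, (1 / L) ^ #X * (1 - 1 / L) ^ vol G X := by
          refine Finset.sum_le_sum fun X hX => ?_
          rw [Finset.sum_const, nsmul_eq_mul, (Finset.mem_filter.1 hX).2.1]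
          exact le_mul_of_one_le_left (by positivity) (by exact_mod_cast hk1)
      _ = ∑ v : Fin n, ∑ X ∈ K with v ∈ X, (1 / L) ^ #X * (1 - 1 / L) ^ vol G X :=
          Finset.sum_comm' (by simp)
      _ ≤ ∑ _v : Fin n, 1 := by
          refine Finset.sum_le_sum fun v _ =>
            SimpleGraph.sum_connected_weight_le_one hp₀ hp₁ v _ fun X hX => ?_
          obtain ⟨hX, hv⟩ := Finset.mem_filter.1 hX
          exact ⟨hv, (Finset.mem_filter.1 hX).2.2.1⟩
      _ = n := by simp
  calc orientProb G (fun f => ∃ X : Finset (Fin n), X.card = k ∧ BadSet G f X)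
      ≤ ∑ X ∈ K, 2 * (L * (9 / L ^ 4)) ^ k * ((1 / L) ^ #X * (1 - 1 / L) ^ vol G X) :=
        hprob.trans (Finset.sum_le_sum hterm)
    _ = 2 * (L * (9 / L ^ 4)) ^ k * ∑ X ∈ K, (1 / L) ^ #X * (1 - 1 / L) ^ vol G X :=
        (Finset.mul_sum _ _ _).symm
    _ ≤ 2 * (L * (9 / L ^ 4)) ^ k * n := by gcongr
    _ = n * (2 * (L * (9 / L ^ 4)) ^ k) := mul_comm _ _
    _ ≤ _ := card_mul_weight_le hα hnL hk1 hk hL
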